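/- arXiv:2008.08263 — 2 statements merged into one kernel-verified Lean document; each statement's English description precedes it below -/
import Mathlib

section
/- Let Ω ⊂ ℝⁿ be a bounded open set, let φ be a Young function with φ(t) > t for all t > 0, let φ̃ be its convex conjugate, and define ϕ by ϕ(t) = φ(t²) for all t ∈ ℝ. Suppose there is a constant C such that for every f ∈ L^{φ̃}(Ω,dμ) there exists a weak solution (u, ∇_A u) ∈ (W_A^{1,2})₀(Ω) of ∇·A∇u = f in Ω satisfying ess sup_Ω |u| ≤ C‖f‖_{L^{φ̃}(Ω,dμ)}. Then there is a constant C′ such that the Orlicz–Sobolev inequality ‖v‖_{L^ϕ(Ω,dμ)} ≤ C′‖∇_A v‖_{L²(Ω,dμ)} holds for every pair (v, ∇_A v) ∈ (W_A^{1,2})₀(Ω). -/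
open MeasureTheory Filter Topology Set Matrix ENNReal NNReal

noncomputable section

/-- Vectors in `ℝⁿ`. -/
abbrev Vec (n : ℕ) := Fin n → ℝ

/-- The (pointwise) gradient of a real valued function on `ℝⁿ`, via `fderiv`
(junk value `0` at points of non-differentiability). -/
noncomputable def grad {n : ℕ} (w : Vec n → ℝ) (x : Vec n) : Vec n :=
  fun i => fderiv ℝ w x (Pi.single i 1)

/-- The `A`-gradient `∇_A w = B ∇w`, where `A = BᵀB`. -/
noncomputable def Agrad {n : ℕ} (Bm : Vec n → Matrix (Fin n) (Fin n) ℝ)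
    (w : Vec n → ℝ) (x : Vec n) : Vec n :=
  (Bm x) *ᵥ (grad w x)

/-- Lipschitz function with compact support contained in `Ω`. -/
def IsLipCpt {n : ℕ} (Ω : Set (Vec n)) (w : Vec n → ℝ) : Prop :=
  (∃ L, LipschitzWith L w) ∧ HasCompactSupport w ∧ tsupport w ⊆ Ω

/-- Squared euclidean norm of a vector in `ℝⁿ`. -/
noncomputable def sqNorm {n : ℕ} (v : Vec n) : ℝ := ∑ i, (v i) ^ 2

/-- Squared `L²(Ω)` distance of two scalar functions. -/
noncomputable def l2dist {n : ℕ} (Ω : Set (Vec n)) (f g : Vec n → ℝ) : ℝ≥0∞ :=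
  ∫⁻ x in Ω, ENNReal.ofReal ((f x - g x) ^ 2)

/-- Squared `L²(Ω;ℝⁿ)` distance of two vector valued functions. -/
noncomputable def l2distV {n : ℕ} (Ω : Set (Vec n)) (F G : Vec n → Vec n) : ℝ≥0∞ :=
  ∫⁻ x in Ω, ENNReal.ofReal (sqNorm (fun i => F x i - G x i))

/-- The pair `(u, G)` belongs to the degenerate Sobolev space `(W_A^{1,2})₀(Ω)`:
`u ∈ L²(Ω)`, `G ∈ L²(Ω;ℝⁿ)` and there are compactly supported Lipschitz functions `w k`
with `w k → u` in `L²(Ω)` and `B ∇(w k) → G` in `L²(Ω;ℝⁿ)`. -/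
def MemW12zero {n : ℕ} (Ω : Set (Vec n)) (Bm : Vec n → Matrix (Fin n) (Fin n) ℝ)
    (u : Vec n → ℝ) (G : Vec n → Vec n) : Prop :=
  AEMeasurable u (volume.restrict Ω) ∧ AEMeasurable G (volume.restrict Ω) ∧
  (∫⁻ x in Ω, ENNReal.ofReal ((u x) ^ 2)) < ⊤ ∧
  (∫⁻ x in Ω, ENNReal.ofReal (sqNorm (G x))) < ⊤ ∧
  ∃ w : ℕ → Vec n → ℝ,
    (∀ k, IsLipCpt Ω (w k)) ∧
    Tendsto (fun k => l2dist Ω (w k) u) atTop (𝓝 0) ∧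
    Tendsto (fun k => l2distV Ω (fun x => Agrad Bm (w k) x) G) atTop (𝓝 0)

/-- `u` (with `A`-gradient `G`) is a weak solution of `∇·A∇u = f` in `Ω`. -/
def IsWeakSol {n : ℕ} (Ω : Set (Vec n)) (Bm : Vec n → Matrix (Fin n) (Fin n) ℝ)
    (f u : Vec n → ℝ) (G : Vec n → Vec n) : Prop :=
  MemW12zero Ω Bm u G ∧
  ∀ φ : Vec n → ℝ, IsLipCpt Ω φ →
    (∫ x in Ω, ∑ i, G x i * Agrad Bm φ x i) = - ∫ x in Ω, f x * φ x

/-- `B` is a bounded Lipschitz matrix valued function. -/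
def BoundedLipMatrix {n : ℕ} (Bm : Vec n → Matrix (Fin n) (Fin n) ℝ) : Prop :=
  (∃ M : ℝ, ∀ x i j, |Bm x i j| ≤ M) ∧
  (∃ L : NNReal, ∀ i j, LipschitzWith L (fun x => Bm x i j))

/-- The normalized measure `dμ = dx/|Ω|` on `Ω`. -/
noncomputable def normMeasure {n : ℕ} (Ω : Set (Vec n)) : Measure (Vec n) :=
  (volume Ω)⁻¹ • volume.restrict Ω

/-- The convex conjugate (Legendre transform) `θ̃(t) = sup_s (st − θ(s))` of a
`[0,∞]`-valued function, computed with truncated subtraction in `[0,∞]`. -/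
noncomputable def youngConj (θ : ℝ → ℝ≥0∞) (t : ℝ) : ℝ≥0∞ :=
  ⨆ s : ℝ, ENNReal.ofReal (s * t) - θ s

/-- `θ : ℝ → [0,∞]` is a Young function. -/
structure IsYoung (θ : ℝ → ℝ≥0∞) : Prop where
  convex : ∀ x y a b : ℝ, 0 ≤ a → 0 ≤ b → a + b = 1 →
    θ (a * x + b * y) ≤ ENNReal.ofReal a * θ x + ENNReal.ofReal b * θ y
  lsc : LowerSemicontinuous θ
  even : ∀ t, θ (-t) = θ t
  zero : θ 0 = 0
  nontrivial : ∃ t > 0, θ t ≠ 0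
  conj_nontrivial : ∃ t > 0, youngConj θ t ≠ 0

/-- The Luxemburg norm `‖f‖_{L^θ(μ)} = inf {k > 0 : ∫ θ(f/k) dμ ≤ 1}`, with `inf ∅ = ∞`. -/
noncomputable def luxNorm {α : Type*} [MeasurableSpace α] (θ : ℝ → ℝ≥0∞)
    (μ : Measure α) (f : α → ℝ) : ℝ≥0∞ :=
  sInf (ENNReal.ofReal '' {k : ℝ | 0 < k ∧ ∫⁻ x, θ (f x / k) ∂μ ≤ 1})

/-- The Orlicz bump function `Φ_N`: `Φ_N(t) = t (ln t)^N` for `t ≥ e^{2N}` and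
`Φ_N(t) = (2N)^N t` for `0 ≤ t ≤ e^{2N}`, extended evenly. -/
noncomputable def orliczBump (N : ℝ) (t : ℝ) : ℝ≥0∞ :=
  if |t| ≤ Real.exp (2 * N) then ENNReal.ofReal ((2 * N) ^ N * |t|)
  else ENNReal.ofReal (|t| * Real.log |t| ^ N)

end

/-! ### Part 1: convex duality -/

lemma fenchel_moreau_rat {θ : ℝ → ℝ≥0∞} (hθ : IsYoung θ) {t r : ℝ} (ht : 0 ≤ t) (hr : 0 ≤ r)
    (h : ENNReal.ofReal r < θ t) :
    ∃ q : ℚ, 0 < q ∧ ENNReal.ofReal r + youngConj θ (q : ℝ) < ENNReal.ofReal ((q : ℝ) * t) := by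
  set E : Set (ℝ × ℝ) := {p | θ p.1 ≤ ENNReal.ofReal p.2 ∧ 0 ≤ p.2} with hE
  have hEc : IsClosed E := by
    have h1 : IsClosed {p : ℝ × ℝ | θ p.1 ≤ ENNReal.ofReal p.2} := by
      have := hθ.lsc.isClosed_epigraph
      exact this.preimage (f := fun p : ℝ × ℝ => (p.1, ENNReal.ofReal p.2))
        (continuous_fst.prodMk (ENNReal.continuous_ofReal.comp continuous_snd))
    exact h1.inter (isClosed_le continuous_const continuous_snd)
  have hEconv : Convex ℝ E := by
    rintro ⟨x1, y1⟩ ⟨h1, h1'⟩ ⟨x2, y2⟩ ⟨h2, h2'⟩ a b ha hb hab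
    simp only at h1 h1' h2 h2'
    refine ⟨?_, ?_⟩
    · simp only [Prod.fst_add, Prod.smul_fst, smul_eq_mul, Prod.snd_add, Prod.smul_snd]
      refine (hθ.convex x1 x2 a b ha hb hab).trans ?_
      rw [ENNReal.ofReal_add (by positivity) (by positivity), ENNReal.ofReal_mul ha,
        ENNReal.ofReal_mul hb]
      gcongr
    · simp only [Prod.snd_add, Prod.smul_snd, smul_eq_mul]; positivity
  have hnot : (t, r) ∉ E := fun hh => absurd hh.1 (not_le.mpr h)
  obtain ⟨f, u, hf1, hf2⟩ := geometric_hahn_banach_closed_point hEconv hEc hnot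
  have hfe : ∀ x y : ℝ, f (x, y) = f (1, 0) * x + f (0, 1) * y := by
    intro x y
    have : ((x, y) : ℝ × ℝ) = x • (1, 0) + y • (0, 1) := by ext <;> simp
    rw [this, map_add, map_smul, map_smul]; simp [mul_comm]
  set a := f (1, 0)
  set b := f (0, 1)
  have h0 : ∀ y : ℝ, 0 ≤ y → b * y < u := by
    intro y hy
    have := hf1 (0, y) ⟨by simp [hθ.zero], hy⟩
    rw [hfe] at this; simpa using this
  have hu : 0 < u := by simpa using h0 0 le_rfl
  have hb : b ≤ 0 := by
    by_contra hb
    push Not at hb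
    have := h0 (u / b) (by positivity)
    rw [mul_div_cancel₀ _ hb.ne'] at this
    exact lt_irrefl _ this
  rw [hfe] at hf2
  have key : ∃ s c : ℝ, 0 < c ∧ r + c < s * t ∧ ∀ x y, (x, y) ∈ E → s * x - y ≤ c := by
    rcases hb.lt_or_eq with hb | hb
    · refine ⟨a / (-b), u / (-b), div_pos hu (by linarith), ?_, ?_⟩
      · have hb' : 0 < -b := by linarith
        rw [← sub_pos]
        have : a / (-b) * t - (r + u / (-b)) = (a * t + b * r - u) / (-b) := by
          have hb0 : b ≠ 0 := hb.ne
          field_simp; ring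
        rw [this]; apply div_pos <;> linarith
      · intro x y hxy
        have hb' : 0 < -b := by linarith
        have h1 := hf1 _ hxy
        rw [hfe] at h1
        rw [← sub_nonneg]
        have : u / (-b) - (a / (-b) * x - y) = (u - (a * x + b * y)) / (-b) := by
          have hb0 : b ≠ 0 := hb.ne
          field_simp; ring
        rw [this]; apply div_nonneg <;> linarith
    · have hpos : 0 < a * t - u := by rw [hb] at hf2; linarith
      have hN : 0 < (r + 1) / (a * t - u) := by positivity
      refine ⟨(r + 1) / (a * t - u) * a, (r + 1) / (a * t - u) * u, by positivity, ?_, ?_⟩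
      · have : (r + 1) / (a * t - u) * a * t = (r+1) / (a * t - u) * u + (r + 1) := by
          field_simp; ring
        linarith
      · intro x y hxy
        have h1 := hf1 _ hxy
        rw [hfe, hb] at h1
        have : (r + 1) / (a * t - u) * (a * x) ≤ (r + 1) / (a * t - u) * u :=
          mul_le_mul_of_nonneg_left (by linarith) hN.le
        have h2 : 0 ≤ y := hxy.2
        linarith
  obtain ⟨s, c, hc, hsc, hE'⟩ := key
  have htpos : 0 < t := by
    rcases ht.lt_or_eq with h | h
    · exact h
    · rw [← h] at hsc; simp at hsc; linarith
  obtain ⟨q, hq1, hq2⟩ := exists_rat_btwn ((div_lt_iff₀ htpos).mpr hsc)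
  have hq0 : (0 : ℝ) < q := lt_of_le_of_lt (by positivity) hq1
  refine ⟨q, by exact_mod_cast hq0, ?_⟩
  have hconj : youngConj θ (q : ℝ) ≤ ENNReal.ofReal c := by
    refine iSup_le fun x => ?_
    rw [tsub_le_iff_right]
    by_cases hx : θ x = ⊤
    · simp [hx]
    · have hm : (x, (θ x).toReal) ∈ E := ⟨by simp [ENNReal.ofReal_toReal hx], ENNReal.toReal_nonneg⟩
      have h1 := hE' _ _ hm
      rw [← ENNReal.ofReal_toReal hx, ← ENNReal.ofReal_add hc.le ENNReal.toReal_nonneg]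
      apply ENNReal.ofReal_le_ofReal
      have h3 : 0 ≤ (θ x).toReal := ENNReal.toReal_nonneg
      rcases le_total 0 x with h2 | h2
      · nlinarith
      · nlinarith
  calc ENNReal.ofReal r + youngConj θ (q : ℝ) ≤ ENNReal.ofReal r + ENNReal.ofReal c := by gcongr
    _ = ENNReal.ofReal (r + c) := (ENNReal.ofReal_add hr hc.le).symm
    _ < _ := by
      rw [div_lt_iff₀ htpos] at hq1
      exact (ENNReal.ofReal_lt_ofReal_iff (by positivity)).mpr hq1

/-- The affine minorants. -/
noncomputable def affMin (θ : ℝ → ℝ≥0∞) (q : ℚ) (t : ℝ) : ℝ≥0∞ :=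
  ENNReal.ofReal (|(q : ℝ)| * t) - youngConj θ |(q : ℝ)|

lemma measurable_affMin (θ : ℝ → ℝ≥0∞) (q : ℚ) : Measurable (affMin θ q) := by
  unfold affMin; fun_prop

lemma le_iSup_affMin {θ : ℝ → ℝ≥0∞} (hθ : IsYoung θ) {e : ℕ → ℚ} (he : Function.Surjective e)
    {t : ℝ} (ht : 0 ≤ t) : θ t ≤ ⨆ j, affMin θ (e j) t := by
  refine le_of_forall_lt fun x hx => ?_
  have hxt : x ≠ ⊤ := ne_top_of_lt hx
  rw [← ENNReal.ofReal_toReal hxt] at hx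
  obtain ⟨q, hq, h⟩ := fenchel_moreau_rat hθ ht ENNReal.toReal_nonneg hx
  rw [ENNReal.ofReal_toReal hxt] at h
  obtain ⟨j, rfl⟩ := he q
  refine lt_of_lt_of_le ?_ (le_iSup _ j)
  unfold affMin
  rw [lt_tsub_iff_right, abs_of_pos (by exact_mod_cast hq)]
  exact h

lemma youngConj_zero (θ : ℝ → ℝ≥0∞) : youngConj θ 0 = 0 := by
  simp [youngConj]

lemma exists_selector (θ : ℝ → ℝ≥0∞) (e : ℕ → ℚ) (m : ℕ) :
    ∃ (σ : ℝ → ℝ) (F : ℝ → ℝ≥0∞) (R : ℝ) (N : ℝ≥0∞), Measurable σ ∧ Measurable F ∧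
      (∀ t, 0 ≤ σ t) ∧ (∀ t, σ t ≤ R) ∧ N < ⊤ ∧ (∀ t, youngConj θ (σ t) ≤ N) ∧
      (∀ t, F t = ⨆ j, ⨆ _ : j < m, affMin θ (e j) t) ∧
      ∀ t, F t + youngConj θ (σ t) ≤ ENNReal.ofReal (σ t * t) := by
  induction m with
  | zero =>
    refine ⟨fun _ => 0, fun _ => 0, 0, 0, by fun_prop, by fun_prop, by simp, by simp, by simp,
      by simp [youngConj_zero], by simp, by simp [youngConj_zero]⟩
  | succ m ih =>
    obtain ⟨σ, F, R, N, hσ, hF, h0, hR, hN, hconj, hFe, hkey⟩ := ih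
    have hmeas : MeasurableSet {t | F t < affMin θ (e m) t} :=
      measurableSet_lt hF (measurable_affMin θ _)
    by_cases hfin : youngConj θ |(e m : ℝ)| = ⊤
    · refine ⟨σ, F, R, N, hσ, hF, h0, hR, hN, hconj, ?_, hkey⟩
      intro t
      rw [Nat.iSup_lt_succ, ← hFe]
      simp [affMin, hfin]
    classical
    refine ⟨fun t => if F t < affMin θ (e m) t then |(e m : ℝ)| else σ t,
      fun t => F t ⊔ affMin θ (e m) t, max R |(e m : ℝ)|, max N (youngConj θ |(e m : ℝ)|),
      Measurable.ite hmeas measurable_const hσ, hF.sup (measurable_affMin θ _), ?_, ?_, ?_, ?_,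
      ?_, ?_⟩
    · intro t; dsimp only; split_ifs; exacts [abs_nonneg _, h0 t]
    · intro t; dsimp only; split_ifs; exacts [le_max_right _ _, (hR t).trans (le_max_left _ _)]
    · exact max_lt hN (lt_top_iff_ne_top.mpr hfin)
    · intro t; dsimp only; split_ifs; exacts [le_max_right _ _, (hconj t).trans (le_max_left _ _)]
    · intro t; rw [Nat.iSup_lt_succ, ← hFe]
    · intro t
      dsimp only
      split_ifs with h
      · rw [sup_eq_right.mpr h.le]
        unfold affMin
        rw [tsub_add_cancel_of_le]
        have : 0 < affMin θ (e m) t := lt_of_le_of_lt (zero_le) h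
        exact (tsub_pos_iff_lt.mp this).le
      · rw [sup_eq_left.mpr (not_lt.mp h)]
        exact hkey t

lemma youngConj_div_le (θ : ℝ → ℝ≥0∞) {J : ℝ} (hJ : 1 ≤ J) (t : ℝ) :
    youngConj θ (t / J) ≤ ENNReal.ofReal J⁻¹ * youngConj θ t := by
  refine iSup_le fun s => ?_
  have hJ0 : 0 < J := by linarith
  have h1 : ENNReal.ofReal J⁻¹ ≤ 1 := by
    rw [← ENNReal.ofReal_one]
    exact ENNReal.ofReal_le_ofReal (inv_le_one_of_one_le₀ hJ)
  have h2 : ENNReal.ofReal (s * t) ≤ youngConj θ t + θ s := by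
    rw [← tsub_le_iff_right]
    exact le_iSup (fun s => ENNReal.ofReal (s * t) - θ s) s
  rw [tsub_le_iff_right]
  calc ENNReal.ofReal (s * (t / J)) = ENNReal.ofReal J⁻¹ * ENNReal.ofReal (s * t) := by
        rw [← ENNReal.ofReal_mul (by positivity)]; congr 1; field_simp
    _ ≤ ENNReal.ofReal J⁻¹ * (youngConj θ t + θ s) := by gcongr
    _ = ENNReal.ofReal J⁻¹ * youngConj θ t + ENNReal.ofReal J⁻¹ * θ s := mul_add _ _ _
    _ ≤ ENNReal.ofReal J⁻¹ * youngConj θ t + 1 * θ s := by gcongr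
    _ = _ := by rw [one_mul]

lemma orlicz_duality {α : Type*} [MeasurableSpace α] {μ : Measure α} [IsProbabilityMeasure μ]
    {θ : ℝ → ℝ≥0∞} (hθ : IsYoung θ) {h : α → ℝ} (hh : AEMeasurable h μ) (h0 : ∀ x, 0 ≤ h x)
    (H : ∀ (f : α → ℝ) (R J : ℝ), AEMeasurable f μ → (∀ x, 0 ≤ f x) → (∀ x, f x ≤ R) → 1 ≤ J →
      ∫⁻ x, youngConj θ (f x / J) ∂μ ≤ 1 →
      ∫⁻ x, ENNReal.ofReal (f x * h x) ∂μ ≤ ENNReal.ofReal J) :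
    ∫⁻ x, θ (h x) ∂μ ≤ 1 := by
  obtain ⟨e, he⟩ := exists_surjective_nat ℚ
  choose σ F R N hσ hF hσ0 hR hN hconj hFe hkey using exists_selector θ e
  have hmono : ∀ t, Monotone fun m => F m t := by
    intro t m m' hmm
    simp only [hFe]
    exact iSup_mono fun j => iSup_mono' fun hj => ⟨hj.trans_le hmm, le_rfl⟩
  have hsup : ∀ t, 0 ≤ t → θ t ≤ ⨆ m, F m t := by
    intro t ht
    refine (le_iSup_affMin hθ he ht).trans (iSup_le fun j => ?_)
    refine le_trans ?_ (le_iSup _ (j + 1))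
    rw [hFe]
    exact le_iSup₂_of_le j (Nat.lt_succ_self j) le_rfl
  calc ∫⁻ x, θ (h x) ∂μ ≤ ∫⁻ x, ⨆ m, F m (h x) ∂μ := lintegral_mono fun x => hsup _ (h0 x)
    _ = ⨆ m, ∫⁻ x, F m (h x) ∂μ :=
      lintegral_iSup' (fun m => (hF m).comp_aemeasurable hh)
        (Eventually.of_forall fun x => hmono (h x))
    _ ≤ 1 := iSup_le fun m => ?_
  set J' := ∫⁻ x, youngConj θ (σ m (h x)) ∂μ with hJ'
  have hJfin : J' ≠ ⊤ := by
    apply ne_top_of_le_ne_top (hN m).ne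
    calc J' ≤ ∫⁻ x, N m ∂μ := lintegral_mono fun x => hconj m _
      _ = N m := by simp
  set J := max 1 J'.toReal with hJ
  have hJ1 : 1 ≤ J := le_max_left _ _
  have hJ0 : 0 < J := by linarith
  have hofJ : ENNReal.ofReal J = max 1 J' := by
    rw [hJ, ENNReal.ofReal_max, ENNReal.ofReal_one, ENNReal.ofReal_toReal hJfin]
  have hle : ∫⁻ x, youngConj θ (σ m (h x) / J) ∂μ ≤ 1 := by
    calc ∫⁻ x, youngConj θ (σ m (h x) / J) ∂μ
        ≤ ∫⁻ x, ENNReal.ofReal J⁻¹ * youngConj θ (σ m (h x)) ∂μ :=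
          lintegral_mono fun x => youngConj_div_le θ hJ1 _
      _ = ENNReal.ofReal J⁻¹ * J' := lintegral_const_mul' _ _ ENNReal.ofReal_ne_top
      _ ≤ ENNReal.ofReal J⁻¹ * ENNReal.ofReal J := by rw [hofJ]; gcongr; exact le_max_right _ _
      _ = 1 := by
        rw [← ENNReal.ofReal_mul (by positivity), inv_mul_cancel₀ hJ0.ne', ENNReal.ofReal_one]
  have h1 := H (fun x => σ m (h x)) (R m) J ((hσ m).comp_aemeasurable hh) (fun x => hσ0 m _)
    (fun x => hR m _) hJ1 hle
  have h2 : ∫⁻ x, F m (h x) ∂μ + J' ≤ max 1 J' := by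
    rw [← hofJ]
    refine le_trans ?_ h1
    refine (le_lintegral_add _ _).trans (lintegral_mono fun x => hkey m _)
  rcases le_total J' 1 with h3 | h3
  · rw [max_eq_left h3] at h2
    exact le_self_add.trans h2
  · rw [max_eq_right h3] at h2
    have : ∫⁻ x, F m (h x) ∂μ ≤ 0 := by
      apply (ENNReal.add_le_add_iff_right hJfin).mp
      simpa using h2
    exact this.trans zero_le_one

/-! ### Part 2: the energy estimate -/

lemma eLpNorm_two_eq {α : Type*} [MeasurableSpace α] (μ : Measure α) (g : α → ℝ) :
    eLpNorm g 2 μ = (∫⁻ x, ENNReal.ofReal (g x ^ 2) ∂μ) ^ (1 / 2 : ℝ) := by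
  rw [eLpNorm_eq_lintegral_rpow_enorm_toReal (by norm_num) (by norm_num)]
  simp only [ENNReal.toReal_ofNat]
  congr 1
  refine lintegral_congr fun x => ?_
  rw [← ofReal_norm, ENNReal.ofReal_rpow_of_nonneg (norm_nonneg _) (by norm_num)]
  congr 1
  rw [Real.norm_eq_abs, Real.rpow_two, sq_abs]

lemma memLp_two_of_lintegral {α : Type*} [MeasurableSpace α] {μ : Measure α} {g : α → ℝ}
    (hg : AEMeasurable g μ) (h : ∫⁻ x, ENNReal.ofReal (g x ^ 2) ∂μ < ⊤) : MemLp g 2 μ := by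
  refine ⟨hg.aestronglyMeasurable, ?_⟩
  rw [eLpNorm_two_eq]
  exact ENNReal.rpow_lt_top_of_nonneg (by norm_num) h.ne

lemma tendsto_eLpNorm_two {α : Type*} [MeasurableSpace α] {μ : Measure α} {b : α → ℝ}
    {bk : ℕ → α → ℝ}
    (h : Tendsto (fun k => ∫⁻ x, ENNReal.ofReal ((bk k x - b x) ^ 2) ∂μ) atTop (𝓝 0)) :
    Tendsto (fun k => eLpNorm (bk k - b) 2 μ) atTop (𝓝 0) := by
  simp only [eLpNorm_two_eq, Pi.sub_apply]
  have := h.ennrpow_const (1 / 2 : ℝ)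
  simpa using this

lemma tendsto_integral_mul {α : Type*} [MeasurableSpace α] {μ : Measure α} {a b : α → ℝ}
    {bk : ℕ → α → ℝ} (ha : MemLp a 2 μ) (hbk : ∀ k, MemLp (bk k) 2 μ) (hb : MemLp b 2 μ)
    (h : Tendsto (fun k => ∫⁻ x, ENNReal.ofReal ((bk k x - b x) ^ 2) ∂μ) atTop (𝓝 0)) :
    Tendsto (fun k => ∫ x, a x * bk k x ∂μ) atTop (𝓝 (∫ x, a x * b x ∂μ)) := by
  have h2 := tendsto_eLpNorm_two h
  refine tendsto_integral_of_L1' _ (ha.1.mul hb.1)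
    (Eventually.of_forall fun k => ha.integrable_mul (hbk k)) ?_
  have h3 : Tendsto (fun k => eLpNorm a 2 μ * eLpNorm (bk k - b) 2 μ) atTop (𝓝 0) := by
    have := ENNReal.Tendsto.const_mul h2 (Or.inr ha.2.ne)
    simpa using this
  refine tendsto_of_tendsto_of_tendsto_of_le_of_le tendsto_const_nhds h3 (fun _ => zero_le) ?_
  intro k
  have : ((fun x => a x * bk k x) - a * b) = a • (bk k - b) := by
    ext x; simp [mul_sub]
  dsimp only
  rw [this]
  exact eLpNorm_smul_le_mul_eLpNorm ((hbk k).1.sub hb.1) ha.1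

lemma memLp_bdd_mul_two {α : Type*} [MeasurableSpace α] {μ : Measure α} {a c : α → ℝ}
    (ha : MemLp a 2 μ) (hc : AEMeasurable c μ) {M : ℝ} (hM : ∀ x, |c x| ≤ M) :
    MemLp (fun x => c x * a x) 2 μ := by
  refine ha.of_le_mul (c := M) (hc.aestronglyMeasurable.mul ha.1) (Eventually.of_forall fun x => ?_)
  rw [norm_mul]
  exact mul_le_mul_of_nonneg_right (hM x) (norm_nonneg _)

lemma memLp_two_of_bdd {α : Type*} [MeasurableSpace α] {μ : Measure α} [IsFiniteMeasure μ]
    {c : α → ℝ} (hc : AEMeasurable c μ) {M : ℝ} (hM : ∀ x, |c x| ≤ M) : MemLp c 2 μ :=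
  MemLp.of_bound hc.aestronglyMeasurable M (Eventually.of_forall hM)

section
variable {n : ℕ} {Ω : Set (Vec n)} {Bm : Vec n → Matrix (Fin n) (Fin n) ℝ}

lemma IsLipCpt.measurable {w : Vec n → ℝ} (hw : IsLipCpt Ω w) : Measurable w := by
  obtain ⟨⟨L, hL⟩, -⟩ := hw
  exact hL.continuous.measurable

lemma IsLipCpt.bdd {w : Vec n → ℝ} (hw : IsLipCpt Ω w) : ∃ M, 0 ≤ M ∧ ∀ x, |w x| ≤ M := by
  obtain ⟨⟨L, hL⟩, hc, -⟩ := hw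
  obtain ⟨M, hM⟩ := hc.exists_bound_of_continuous hL.continuous
  exact ⟨M, (norm_nonneg _).trans (hM 0), hM⟩

/-- Product of two Lipschitz functions with compact support. -/
lemma IsLipCpt.mul {w z : Vec n → ℝ} (hw : IsLipCpt Ω w) (hz : IsLipCpt Ω z) :
    IsLipCpt Ω (fun x => w x * z x) := by
  obtain ⟨M, hM0, hM⟩ := hw.bdd
  obtain ⟨M', hM0', hM'⟩ := hz.bdd
  obtain ⟨⟨L, hL⟩, hc, hs⟩ := hw
  obtain ⟨⟨L', hL'⟩, hc', hs'⟩ := hz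
  refine ⟨⟨(M * L' + M' * L).toNNReal, LipschitzWith.of_dist_le_mul fun x y => ?_⟩,
    hc.mul_right, (tsupport_mul_subset_left).trans hs⟩
  rw [Real.coe_toNNReal _ (by positivity), Real.dist_eq]
  have h1 := hL.dist_le_mul x y
  have h2 := hL'.dist_le_mul x y
  rw [Real.dist_eq] at h1 h2
  have : w x * z x - w y * z y = w x * (z x - z y) + (w x - w y) * z y := by ring
  rw [this]
  calc |w x * (z x - z y) + (w x - w y) * z y| ≤ |w x| * |z x - z y| + |w x - w y| * |z y| := by
        rw [← abs_mul, ← abs_mul]; exact abs_add_le _ _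
    _ ≤ M * (L' * dist x y) + (L * dist x y) * M' := by
        gcongr
        exacts [hM x, hM' y]
    _ = _ := by ring

lemma measurable_Agrad (hBm : BoundedLipMatrix Bm) (w : Vec n → ℝ) (i : Fin n) :
    Measurable fun x => Agrad Bm w x i := by
  obtain ⟨-, L, hL⟩ := hBm
  simp only [Agrad, Matrix.mulVec, dotProduct, grad]
  refine Finset.measurable_sum _ fun j _ => ?_
  exact (hL i j).continuous.measurable.mul (measurable_fderiv_apply_const ℝ w _)

lemma Agrad_bdd (hBm : BoundedLipMatrix Bm) {w : Vec n → ℝ} (hw : IsLipCpt Ω w) :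
    ∃ M, 0 ≤ M ∧ ∀ x i, |Agrad Bm w x i| ≤ M := by
  obtain ⟨⟨M, hM⟩, -⟩ := hBm
  obtain ⟨⟨L, hL⟩, -⟩ := hw
  have hnn : (0 : ℝ) ≤ ∑ j : Fin n, |M| * (L * ‖(Pi.single j 1 : Vec n)‖) := by positivity
  refine ⟨_, hnn, fun x i => ?_⟩
  simp only [Agrad, Matrix.mulVec, dotProduct, grad]
  refine (Finset.abs_sum_le_sum_abs _ _).trans (Finset.sum_le_sum fun j _ => ?_)
  rw [abs_mul]
  have h1 : |Bm x i j| ≤ |M| := (hM x i j).trans (le_abs_self M)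
  have h2 : |fderiv ℝ w x (Pi.single j 1)| ≤ L * ‖(Pi.single j 1 : Vec n)‖ := by
    refine ((fderiv ℝ w x).le_opNorm _).trans ?_
    gcongr
    exact norm_fderiv_le_of_lipschitz ℝ hL
  gcongr

lemma Agrad_mul_ae {w z : Vec n → ℝ} (hw : IsLipCpt Ω w) (hz : IsLipCpt Ω z) :
    ∀ᵐ x ∂(volume.restrict Ω), ∀ i,
      Agrad Bm (fun x => w x * z x) x i = w x * Agrad Bm z x i + z x * Agrad Bm w x i := by
  obtain ⟨⟨L, hL⟩, -⟩ := hw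
  obtain ⟨⟨L', hL'⟩, -⟩ := hz
  filter_upwards [ae_restrict_of_ae hL.ae_differentiableAt,
    ae_restrict_of_ae hL'.ae_differentiableAt] with x h1 h2 i
  simp only [Agrad, Matrix.mulVec, dotProduct, grad]
  rw [Finset.mul_sum, Finset.mul_sum, ← Finset.sum_add_distrib]
  refine Finset.sum_congr rfl fun j _ => ?_
  rw [fderiv_fun_mul h1 h2]
  simp
  ring

lemma energy [IsFiniteMeasure (volume.restrict Ω)] (hBm : BoundedLipMatrix Bm)
    {f u : Vec n → ℝ} {G : Vec n → Vec n} (hf : AEMeasurable f (volume.restrict Ω))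
    (hf0 : ∀ x, 0 ≤ f x) {R : ℝ} (hfR : ∀ x, f x ≤ R) (hsol : IsWeakSol Ω Bm f u G)
    {c : ℝ} (hc : 0 < c) (huc : ∀ᵐ x ∂(volume.restrict Ω), |u x| ≤ c)
    {w : Vec n → ℝ} (hw : IsLipCpt Ω w) :
    Integrable (fun x => f x * w x ^ 2) (volume.restrict Ω) ∧
    Integrable (fun x => sqNorm (Agrad Bm w x)) (volume.restrict Ω) ∧
    ∫ x in Ω, f x * w x ^ 2 ≤ 8 * c * ∫ x in Ω, sqNorm (Agrad Bm w x) := by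
  obtain ⟨⟨hu, hG, hu2, hG2, uk, huk, huk1, huk2⟩, hweak⟩ := hsol
  set μ := volume.restrict Ω with hμ
  obtain ⟨Mw, hMw0, hMw⟩ := hw.bdd
  obtain ⟨MD, hMD0, hMD⟩ := Agrad_bdd hBm hw
  set D : Vec n → Vec n := Agrad Bm w with hD
  have hwm : AEMeasurable w μ := hw.measurable.aemeasurable
  have hDm : ∀ i, AEMeasurable (fun x => D x i) μ := fun i => (measurable_Agrad hBm w i).aemeasurable
  have hGm : ∀ i, AEMeasurable (fun x => G x i) μ := fun i => (aemeasurable_pi_iff.mp hG) i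
  have hGi : ∀ i, MemLp (fun x => G x i) 2 μ := by
    intro i
    refine memLp_two_of_lintegral (hGm i) (lt_of_le_of_lt (lintegral_mono fun x => ?_) hG2)
    apply ENNReal.ofReal_le_ofReal
    exact Finset.single_le_sum (f := fun i => G x i ^ 2) (fun i _ => sq_nonneg _) (Finset.mem_univ i)
  have hDi : ∀ i, MemLp (fun x => D x i) 2 μ := fun i => memLp_two_of_bdd (hDm i) (fun x => hMD x i)
  have hum : MemLp u 2 μ := memLp_two_of_lintegral hu hu2
  have hukm : ∀ k, MemLp (uk k) 2 μ := fun k => by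
    obtain ⟨M, -, hM⟩ := (huk k).bdd
    exact memLp_two_of_bdd (huk k).measurable.aemeasurable hM
  have hgk : ∀ k i, MemLp (fun x => Agrad Bm (uk k) x i) 2 μ := fun k i => by
    obtain ⟨M, -, hM⟩ := Agrad_bdd hBm (huk k)
    exact memLp_two_of_bdd (measurable_Agrad hBm _ i).aemeasurable (fun x => hM x i)
  have hw2 : ∀ x, |w x ^ 2| ≤ Mw ^ 2 := fun x => by
    rw [abs_pow]; exact pow_le_pow_left₀ (abs_nonneg _) (hMw x) 2
  have hR0 : 0 ≤ R := (hf0 0).trans (hfR 0)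
  have hfw : ∀ x, |f x * w x ^ 2| ≤ R * Mw ^ 2 := fun x => by
    rw [abs_mul, abs_of_nonneg (hf0 x)]
    exact mul_le_mul (hfR x) (hw2 x) (abs_nonneg _) hR0
  have hfwL : MemLp (fun x => f x * w x ^ 2) 2 μ :=
    memLp_two_of_bdd (hf.mul (hwm.pow_const 2)) hfw
  have hfwI : Integrable (fun x => f x * w x ^ 2) μ := hfwL.integrable (by norm_num)
  -- the function `P = 2 w G · D`
  set P : Vec n → ℝ := fun x => ∑ i, 2 * w x * D x i * G x i with hP
  have hPL : MemLp P 2 μ := by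
    refine memLp_finsetSum _ fun i _ => ?_
    refine memLp_bdd_mul_two (hGi i) (c := fun x => 2 * w x * D x i) ?_ (M := 2 * Mw * MD) ?_
    · exact (hwm.const_mul 2).mul (hDm i)
    · intro x
      rw [abs_mul, abs_mul, abs_two]
      have := hMw x
      have := hMD x i
      gcongr
  have hPI : Integrable P μ := hPL.integrable (by norm_num)
  have hwGL : ∀ i, MemLp (fun x => w x ^ 2 * G x i) 2 μ := fun i =>
    memLp_bdd_mul_two (hGi i) (hwm.pow_const 2) hw2
  -- first test function
  have test1 : ∫ x, P x ∂μ = - ∫ x, f x * w x ^ 2 ∂μ := by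
    have h := hweak _ (hw.mul hw)
    have e1 : ∫ x, P x ∂μ = ∫ x in Ω, ∑ i, G x i * Agrad Bm (fun x => w x * w x) x i := by
      refine integral_congr_ae ?_
      filter_upwards [Agrad_mul_ae (Bm := Bm) hw hw] with x hx
      refine Finset.sum_congr rfl fun i _ => ?_
      rw [hx i]; simp only [hD]; ring
    rw [e1, h]
    simp only [pow_two]
  -- second test functions
  have test2 : ∀ k, (∑ i, ∫ x, (w x ^ 2 * G x i) * Agrad Bm (uk k) x i ∂μ)
      + ∫ x, P x * uk k x ∂μ = - ∫ x, (f x * w x ^ 2) * uk k x ∂μ := by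
    intro k
    have h := hweak _ ((hw.mul hw).mul (huk k))
    have e0 : ∀ i, Integrable (fun x => (w x ^ 2 * G x i) * Agrad Bm (uk k) x i) μ := fun i =>
      (hwGL i).integrable_mul (hgk k i)
    have e2 : Integrable (fun x => P x * uk k x) μ := hPL.integrable_mul (hukm k)
    rw [← integral_finsetSum _ (fun i _ => e0 i), ← integral_add
      (integrable_finsetSum _ (fun i _ => e0 i)) e2]
    have e1 : ∫ x, (f x * w x ^ 2) * uk k x ∂μ = ∫ x in Ω, f x * (w x * w x * uk k x) := by
      refine integral_congr_ae (Eventually.of_forall fun x => ?_)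
      dsimp only; ring
    rw [e1, ← h]
    refine integral_congr_ae ?_
    filter_upwards [Agrad_mul_ae (Bm := Bm) hw hw,
      Agrad_mul_ae (Bm := Bm) (hw.mul hw) (huk k)] with x hx hx2
    simp only [hP]
    rw [Finset.sum_mul, ← Finset.sum_add_distrib]
    refine Finset.sum_congr rfl fun i _ => ?_
    rw [hx2 i, hx i]; simp only [hD]; ring
  have hgconv : ∀ i, Tendsto (fun k => ∫⁻ x, ENNReal.ofReal
      ((Agrad Bm (uk k) x i - G x i) ^ 2) ∂μ) atTop (𝓝 0) := by
    intro i
    refine tendsto_of_tendsto_of_tendsto_of_le_of_le tendsto_const_nhds huk2 (fun _ => zero_le) ?_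
    intro k
    refine lintegral_mono fun x => ?_
    apply ENNReal.ofReal_le_ofReal
    exact Finset.single_le_sum (f := fun i => (Agrad Bm (uk k) x i - G x i) ^ 2)
      (fun i _ => sq_nonneg _) (Finset.mem_univ i)
  have lim : (∑ i, ∫ x, (w x ^ 2 * G x i) * G x i ∂μ)
      + ∫ x, P x * u x ∂μ = - ∫ x, (f x * w x ^ 2) * u x ∂μ := by
    have t1 := tendsto_finsetSum (Finset.univ : Finset (Fin n)) fun i _ =>
      tendsto_integral_mul (hwGL i) (fun k => hgk k i) (hGi i) (hgconv i)
    have t2 := tendsto_integral_mul hPL hukm hum huk1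
    have t3 := (tendsto_integral_mul hfwL hukm hum huk1).neg
    exact tendsto_nhds_unique (t1.add t2) (t3.congr fun k => (test2 k).symm)
  set Q : Vec n → ℝ := fun x => ∑ i, (w x ^ 2 * G x i) * G x i with hQ
  have hQi : ∀ i, Integrable (fun x => (w x ^ 2 * G x i) * G x i) μ := fun i =>
    (hwGL i).integrable_mul (hGi i)
  have hQI : Integrable Q μ := integrable_finsetSum _ fun i _ => hQi i
  have hYI : Integrable (fun x => sqNorm (D x)) μ :=
    integrable_finsetSum _ fun i _ => (hDi i).integrable_sq
  rw [← integral_finsetSum _ (fun i _ => hQi i)] at lim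
  refine ⟨hfwI, hYI, ?_⟩
  set S := ∫ x, f x * w x ^ 2 ∂μ with hS
  set X := ∫ x, Q x ∂μ with hX
  set Y := ∫ x, sqNorm (D x) ∂μ with hY
  have hPt : ∀ x, |P x| ≤ Q x / (4 * c) + 4 * c * sqNorm (D x) := by
    intro x
    simp only [hP, hQ, sqNorm]
    rw [Finset.sum_div, Finset.mul_sum, ← Finset.sum_add_distrib]
    refine (Finset.abs_sum_le_sum_abs _ _).trans (Finset.sum_le_sum fun i _ => ?_)
    rw [div_add' _ _ _ (by positivity), le_div_iff₀ (by positivity)]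
    rcases abs_cases (2 * w x * D x i * G x i) with ⟨h, -⟩ | ⟨h, -⟩ <;> rw [h]
    · nlinarith [sq_nonneg (w x * G x i - 4 * c * D x i)]
    · nlinarith [sq_nonneg (w x * G x i + 4 * c * D x i)]
  have hI1 : Integrable (fun x => Q x / (4 * c) + 4 * c * sqNorm (D x)) μ :=
    (hQI.div_const _).add (hYI.const_mul _)
  have hI1v : ∫ x, (Q x / (4 * c) + 4 * c * sqNorm (D x)) ∂μ = X / (4 * c) + 4 * c * Y := by
    rw [integral_add (hQI.div_const _) (hYI.const_mul _), integral_div, integral_const_mul]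
  have ineq1 : S ≤ X / (4 * c) + 4 * c * Y := by
    have : S = ∫ x, - P x ∂μ := by rw [integral_neg, test1]; ring
    rw [this, ← hI1v]
    exact integral_mono hPI.neg hI1 fun x => (neg_le_abs _).trans (hPt x)
  have hPu : Integrable (fun x => - (P x * u x)) μ := (hPL.integrable_mul hum).neg
  have hfu : Integrable (fun x => (f x * w x ^ 2) * u x) μ := hfwL.integrable_mul hum
  have ineq2 : X ≤ c * (X / (4 * c) + 4 * c * Y) + c * S := by
    have e : X = ∫ x, (- (P x * u x) - (f x * w x ^ 2) * u x) ∂μ := by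
      rw [integral_sub hPu hfu, integral_neg]
      linarith
    rw [← hI1v, e, hS, ← integral_const_mul, ← integral_const_mul,
      ← integral_add (hI1.const_mul _) (hfwI.const_mul _)]
    refine integral_mono_ae (hPu.sub hfu)
      ((hI1.const_mul _).add (hfwI.const_mul _)) ?_
    filter_upwards [huc] with x hx
    have h1 : -(P x * u x) ≤ c * (Q x / (4 * c) + 4 * c * sqNorm (D x)) := by
      refine (neg_le_abs _).trans ?_
      rw [abs_mul, mul_comm]
      exact mul_le_mul hx (hPt x) (abs_nonneg _) hc.le
    have h2 : -((f x * w x ^ 2) * u x) ≤ c * (f x * w x ^ 2) := by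
      have h3 : 0 ≤ f x * w x ^ 2 := mul_nonneg (hf0 x) (sq_nonneg _)
      nlinarith [neg_le_abs (u x)]
    linarith
  have e1 : c * (X / (4 * c) + 4 * c * Y) = X / 4 + 4 * c ^ 2 * Y := by field_simp
  have h3 : c * S ≤ X / 4 + 4 * c ^ 2 * Y := by
    rw [← e1]; exact mul_le_mul_of_nonneg_left ineq1 hc.le
  rw [e1] at ineq2
  have h4 : c * S ≤ c * (8 * c * Y) := by nlinarith
  exact le_of_mul_le_mul_left h4 hc

lemma energy_limit [IsFiniteMeasure (volume.restrict Ω)] (hBm : BoundedLipMatrix Bm)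
    {f u : Vec n → ℝ} {G : Vec n → Vec n} (hf : AEMeasurable f (volume.restrict Ω))
    (hf0 : ∀ x, 0 ≤ f x) {R : ℝ} (hfR : ∀ x, f x ≤ R) (hsol : IsWeakSol Ω Bm f u G)
    {c : ℝ} (hc : 0 < c) (huc : ∀ᵐ x ∂(volume.restrict Ω), |u x| ≤ c)
    {v : Vec n → ℝ} {H : Vec n → Vec n} (hv : MemW12zero Ω Bm v H) :
    ∫⁻ x in Ω, ENNReal.ofReal (f x * v x ^ 2) ≤
      ENNReal.ofReal (16 * c) * ∫⁻ x in Ω, ENNReal.ofReal (sqNorm (H x)) := by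
  obtain ⟨hvm, hHm, hv2, hH2, w, hw, hw1, hw2⟩ := hv
  set μ := volume.restrict Ω with hμ
  have hwm : ∀ k, AEMeasurable (w k) μ := fun k => (hw k).measurable.aemeasurable
  obtain ⟨ns, hns, hae⟩ := (tendstoInMeasure_of_tendsto_eLpNorm (p := 2) (by norm_num)
    (fun k => (hwm k).aestronglyMeasurable) hvm.aestronglyMeasurable
    (tendsto_eLpNorm_two hw1)).exists_seq_tendsto_ae
  set I := ∫⁻ x, ENNReal.ofReal (sqNorm (H x)) ∂μ with hI
  have hHsq : AEMeasurable (fun x => ENNReal.ofReal (sqNorm (H x))) μ := by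
    apply AEMeasurable.ennreal_ofReal
    unfold sqNorm
    exact Finset.aemeasurable_fun_sum _ fun i _ => ((aemeasurable_pi_iff.mp hHm) i).pow_const 2
  have hk : ∀ k, ∫⁻ x, ENNReal.ofReal (f x * w k x ^ 2) ∂μ ≤
      ENNReal.ofReal (8 * c) * (2 * I + 2 * l2distV Ω (fun x => Agrad Bm (w k) x) H) := by
    intro k
    obtain ⟨h1, h2, h3⟩ := energy hBm hf hf0 hfR hsol hc huc (hw k)
    have hsq : ∀ y : Vec n, 0 ≤ sqNorm y := fun y => Finset.sum_nonneg fun i _ => sq_nonneg _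
    rw [← ofReal_integral_eq_lintegral_ofReal h1
      (Eventually.of_forall fun x => mul_nonneg (hf0 x) (sq_nonneg _))]
    refine (ENNReal.ofReal_le_ofReal h3).trans ?_
    rw [ENNReal.ofReal_mul (by positivity), ofReal_integral_eq_lintegral_ofReal h2
      (Eventually.of_forall fun x => hsq _)]
    gcongr
    rw [hI, l2distV, ← lintegral_const_mul' _ _ (by norm_num),
      ← lintegral_const_mul' _ _ (by norm_num), ← lintegral_add_left' (hHsq.const_mul 2)]
    refine lintegral_mono fun x => ?_
    have h2' : (2 : ℝ≥0∞) = ENNReal.ofReal 2 := by simp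
    dsimp only
    rw [h2', ← ENNReal.ofReal_mul (by norm_num), ← ENNReal.ofReal_mul (by norm_num),
      ← ENNReal.ofReal_add (mul_nonneg (by norm_num) (hsq _)) (mul_nonneg (by norm_num) (hsq _))]
    apply ENNReal.ofReal_le_ofReal
    simp only [sqNorm]
    rw [Finset.mul_sum, Finset.mul_sum, ← Finset.sum_add_distrib]
    refine Finset.sum_le_sum fun i _ => ?_
    nlinarith [sq_nonneg (Agrad Bm (w k) x i - 2 * H x i)]
  have hlim : Tendsto (fun k => ENNReal.ofReal (8 * c) *
      (2 * I + 2 * l2distV Ω (fun x => Agrad Bm (w (ns k)) x) H)) atTop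
      (𝓝 (ENNReal.ofReal (8 * c) * (2 * I + 2 * 0))) := by
    refine ENNReal.Tendsto.const_mul ?_ (Or.inr ENNReal.ofReal_ne_top)
    refine tendsto_const_nhds.add ?_
    exact ENNReal.Tendsto.const_mul (hw2.comp hns.tendsto_atTop) (Or.inr (by norm_num))
  calc ∫⁻ x, ENNReal.ofReal (f x * v x ^ 2) ∂μ
      = ∫⁻ x, liminf (fun k => ENNReal.ofReal (f x * w (ns k) x ^ 2)) atTop ∂μ := by
        refine lintegral_congr_ae ?_
        filter_upwards [hae] with x hx
        exact (ENNReal.tendsto_ofReal ((hx.pow 2).const_mul (f x))).liminf_eq.symm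
    _ ≤ liminf (fun k => ∫⁻ x, ENNReal.ofReal (f x * w (ns k) x ^ 2) ∂μ) atTop :=
        lintegral_liminf_le' fun k => (hf.mul ((hwm _).pow_const 2)).ennreal_ofReal
    _ ≤ liminf (fun k => ENNReal.ofReal (8 * c) *
      (2 * I + 2 * l2distV Ω (fun x => Agrad Bm (w (ns k)) x) H)) atTop :=
        liminf_le_liminf (Eventually.of_forall fun k => hk (ns k))
    _ = ENNReal.ofReal (8 * c) * (2 * I + 2 * 0) := hlim.liminf_eq
    _ = ENNReal.ofReal (16 * c) * I := by
        have h2' : (2 : ℝ≥0∞) = ENNReal.ofReal 2 := by simp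
        rw [mul_zero, add_zero, ← mul_assoc, h2', ← ENNReal.ofReal_mul (by positivity)]
        congr 2; ring

end


/-- **Almost necessity.** Let `φ` be a Young function with `φ(t) > t` for `t > 0`,
`φ̃` its convex conjugate, and `ϕ(t) = φ(t²)`. If there is a constant `C` such that for every
`f ∈ L^{φ̃}(Ω,dμ)` there is a weak solution `(u, ∇_A u) ∈ (W_A^{1,2})₀(Ω)` of `∇·A∇u = f`
with `ess sup_Ω |u| ≤ C ‖f‖_{L^{φ̃}(Ω,dμ)}`, then the Orlicz–Sobolev inequality
`‖v‖_{L^ϕ(Ω,dμ)} ≤ C′ ‖∇_A v‖_{L²(Ω,dμ)}` holds for every pair in `(W_A^{1,2})₀(Ω)`. -/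
theorem statement1 {n : ℕ} (Ω : Set (Vec n)) (hΩo : IsOpen Ω) (hΩb : Bornology.IsBounded Ω)
    (Bm : Vec n → Matrix (Fin n) (Fin n) ℝ) (hBm : BoundedLipMatrix Bm)
    (φ : ℝ → ℝ≥0∞) (hφ : IsYoung φ)
    (hφgt : ∀ t : ℝ, 0 < t → ENNReal.ofReal t < φ t)
    (ϕ : ℝ → ℝ≥0∞) (hϕ : ∀ t : ℝ, ϕ t = φ (t ^ 2))
    (C : ℝ)
    (hsol : ∀ f : Vec n → ℝ, AEMeasurable f (volume.restrict Ω) →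
      luxNorm (youngConj φ) (normMeasure Ω) f < ⊤ →
      ∃ u G, IsWeakSol Ω Bm f u G ∧
        eLpNorm u ⊤ (volume.restrict Ω) ≤
          ENNReal.ofReal C * luxNorm (youngConj φ) (normMeasure Ω) f) :
    ∃ C' : ℝ, 0 < C' ∧ ∀ v H, MemW12zero Ω Bm v H →
      luxNorm ϕ (normMeasure Ω) v ≤ ENNReal.ofReal C' *
        (∫⁻ x, ENNReal.ofReal (sqNorm (H x)) ∂(normMeasure Ω)) ^ (1/2 : ℝ) := by
  classical
  set C1 := max C 1 with hC1
  have hC1' : 1 ≤ C1 := le_max_right _ _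
  have hvolfin : volume Ω ≠ ⊤ := hΩb.measure_lt_top.ne
  have : IsFiniteMeasure (volume.restrict Ω) := ⟨by simpa using hΩb.measure_lt_top⟩
  refine ⟨16 * C1, by positivity, fun v H hv => ?_⟩
  set I := ∫⁻ x, ENNReal.ofReal (sqNorm (H x)) ∂(normMeasure Ω) with hI
  by_cases h0 : volume Ω = 0
  · -- trivial case
    have hz : normMeasure Ω = 0 := by
      rw [normMeasure, Measure.restrict_eq_zero.mpr h0, smul_zero]
    refine le_trans ?_ zero_le
    refine ENNReal.le_of_forall_pos_le_add fun ε hε _ => ?_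
    rw [zero_add, ← ENNReal.ofReal_coe_nnreal]
    exact sInf_le ⟨ε, ⟨by exact_mod_cast hε, by simp [hz]⟩, rfl⟩
  have hinv : (volume Ω)⁻¹ ≠ ⊤ := ENNReal.inv_ne_top.mpr h0
  have : IsProbabilityMeasure (normMeasure Ω) := ⟨by
    simp [normMeasure, ENNReal.inv_mul_cancel h0 hvolfin]⟩
  have hac : ∀ {β : Type} [MeasurableSpace β] {g : Vec n → β}, AEMeasurable g (normMeasure Ω) →
      AEMeasurable g (volume.restrict Ω) := by
    intro β _ g hg
    refine hg.mono_ac ?_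
    exact Measure.absolutelyContinuous_smul (ENNReal.inv_ne_zero.mpr hvolfin)
  have hac' : AEMeasurable v (normMeasure Ω) := hv.1.smul_measure _
  have hlin : ∀ g : Vec n → ℝ≥0∞, ∫⁻ x, g x ∂(normMeasure Ω) = (volume Ω)⁻¹ * ∫⁻ x in Ω, g x := by
    intro g
    rw [normMeasure, lintegral_smul_measure, smul_eq_mul]
  have hIfin : I ≠ ⊤ := by
    rw [hI, hlin]
    exact ENNReal.mul_ne_top hinv hv.2.2.2.1.ne
  set y := (I ^ (1 / 2 : ℝ)).toReal with hy
  have hy0 : 0 ≤ y := ENNReal.toReal_nonneg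
  have hyfin : I ^ (1 / 2 : ℝ) ≠ ⊤ := ENNReal.rpow_ne_top_of_nonneg (by norm_num) hIfin
  have hyI : I ^ (1 / 2 : ℝ) = ENNReal.ofReal y := (ENNReal.ofReal_toReal hyfin).symm
  have hIy : I = ENNReal.ofReal (y ^ 2) := by
    rw [ENNReal.ofReal_pow hy0, ← hyI, ← ENNReal.rpow_natCast, ← ENNReal.rpow_mul]
    norm_num
  rw [hyI, ← ENNReal.ofReal_mul (by positivity)]
  refine ENNReal.le_of_forall_pos_le_add fun ε hε _ => ?_
  rw [← ENNReal.ofReal_coe_nnreal, ← ENNReal.ofReal_add (by positivity) ε.coe_nonneg]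
  set k : ℝ := 16 * C1 * y + ε with hk
  have hε' : (0 : ℝ) < ε := by exact_mod_cast hε
  have hkpos : 0 < k := by positivity
  have hky : 16 * C1 * y ^ 2 ≤ k ^ 2 := by
    have h1 : 16 * C1 * y ≤ k := by linarith
    have h2 : (16 * C1 * y) ^ 2 ≤ k ^ 2 := pow_le_pow_left₀ (by positivity) h1 2
    have h3 : 16 * C1 * y ^ 2 ≤ (16 * C1 * y) ^ 2 := by
      have : 0 ≤ y ^ 2 * C1 * (256 * C1 - 16) := by
        apply mul_nonneg (by positivity); linarith
      nlinarith
    linarith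
  refine sInf_le ⟨k, ⟨hkpos, ?_⟩, rfl⟩
  have hfe : ∀ x, ϕ (v x / k) = φ (v x ^ 2 / k ^ 2) := fun x => by rw [hϕ, div_pow]
  simp only [hfe]
  refine orlicz_duality hφ ((hac'.pow_const 2).div_const _) (fun x => by positivity) ?_
  intro f R J hf hf0 hfR hJ hfJ
  have hJ0 : 0 < J := by linarith
  have hlux : luxNorm (youngConj φ) (normMeasure Ω) f ≤ ENNReal.ofReal J :=
    sInf_le ⟨J, ⟨hJ0, hfJ⟩, rfl⟩
  obtain ⟨u, G, hsolu, hub⟩ := hsol f (hac hf) (hlux.trans_lt ENNReal.ofReal_lt_top)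
  have hub' : eLpNorm u ⊤ (volume.restrict Ω) ≤ ENNReal.ofReal (C1 * J) := by
    refine hub.trans ?_
    rw [ENNReal.ofReal_mul (by positivity)]
    exact mul_le_mul' (ENNReal.ofReal_le_ofReal (le_max_left _ _)) hlux
  have huc : ∀ᵐ x ∂(volume.restrict Ω), |u x| ≤ C1 * J := by
    rw [eLpNorm_exponent_top] at hub'
    filter_upwards [ae_le_eLpNormEssSup (f := u) (μ := volume.restrict Ω)] with x hx
    have h1 := hx.trans hub'
    rw [← ofReal_norm, ENNReal.ofReal_le_ofReal_iff (by positivity)] at h1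
    exact h1
  have hmain := energy_limit hBm (hac hf) hf0 hfR hsolu (c := C1 * J) (by positivity) huc hv
  have hmul : ∫⁻ x, ENNReal.ofReal (f x * v x ^ 2) ∂(normMeasure Ω) ≤
      ENNReal.ofReal (16 * (C1 * J)) * I := by
    rw [hI, hlin, hlin, mul_left_comm]
    gcongr
  have hsplit : ∀ x, ENNReal.ofReal (f x * (v x ^ 2 / k ^ 2)) =
      ENNReal.ofReal (k ^ 2)⁻¹ * ENNReal.ofReal (f x * v x ^ 2) := by
    intro x
    rw [← ENNReal.ofReal_mul (by positivity)]
    congr 1; field_simp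
  simp only [hsplit]
  rw [lintegral_const_mul' _ _ ENNReal.ofReal_ne_top]
  calc ENNReal.ofReal (k ^ 2)⁻¹ * ∫⁻ x, ENNReal.ofReal (f x * v x ^ 2) ∂(normMeasure Ω)
      ≤ ENNReal.ofReal (k ^ 2)⁻¹ * (ENNReal.ofReal (16 * (C1 * J)) * ENNReal.ofReal (y ^ 2)) := by
        rw [← hIy]; gcongr
    _ = ENNReal.ofReal ((k ^ 2)⁻¹ * (16 * (C1 * J) * y ^ 2)) := by
        rw [← ENNReal.ofReal_mul (by positivity), ← ENNReal.ofReal_mul (by positivity)]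
    _ ≤ ENNReal.ofReal J := by
        apply ENNReal.ofReal_le_ofReal
        rw [inv_mul_le_iff₀ (by positivity)]
        nlinarith
end

section
/- Let Ω ⊂ ℝⁿ be a bounded open set and suppose the Orlicz–Sobolev inequality ‖w‖_{L^φ(Ω,dμ)} ≤ C (∫_Ω |∇_A w|² dμ)^{1/2} holds for every pair (w, ∇_A w) ∈ (W_A^{1,2})₀(Ω), where φ is a Young function satisfying φ(t) ≥ t² for all t ≥ 0. Then for every f ∈ L^∞(Ω) there exists a pair (u, ∇_A u) ∈ (W_A^{1,2})₀(Ω), unique as a pair, such that u is a weak solution of ∇·A∇u = f in Ω. -/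
open MeasureTheory Filter Topology Set Matrix ENNReal NNReal

section Aux

lemma sq_lint {α F : Type*} [MeasurableSpace α] [NormedAddCommGroup F] (μ : Measure α)
    (f : α → F) : ∫⁻ x, ENNReal.ofReal (‖f x‖ ^ 2) ∂μ = eLpNorm f 2 μ ^ 2 := by
  have h := eLpNorm_nnreal_pow_eq_lintegral (μ := μ) (f := f) (p := 2) (by norm_num)
  have h2 : eLpNorm f 2 μ ^ 2 = eLpNorm f ((2 : ℝ≥0) : ℝ≥0∞) μ ^ (((2 : ℝ≥0) : ℝ)) := by
    norm_num
  rw [h2, h]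
  refine lintegral_congr fun x => ?_
  rw [ENNReal.ofReal_pow (norm_nonneg _), ofReal_norm]
  norm_num

lemma tendsto_sq_zero {a : ℕ → ℝ≥0∞} :
    Tendsto (fun k => a k ^ 2) atTop (𝓝 0) ↔ Tendsto a atTop (𝓝 0) := by
  constructor
  · intro h
    have := ((ENNReal.continuous_rpow_const (y := (1/2 : ℝ))).tendsto 0).comp h
    have h0 : (0 : ℝ≥0∞) ^ (1/2 : ℝ) = 0 := ENNReal.zero_rpow_of_pos (by norm_num)
    rw [h0] at this
    refine this.congr fun k => ?_
    simp only [Function.comp]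
    rw [← ENNReal.rpow_natCast, ← ENNReal.rpow_mul]
    norm_num
  · intro h
    have := ((ENNReal.continuous_pow 2).tendsto 0).comp h
    rw [zero_pow two_ne_zero] at this
    exact this

lemma sqNorm_eq {n : ℕ} (v : Vec n) : sqNorm v = ‖(WithLp.toLp 2 v : EuclideanSpace ℝ (Fin n))‖ ^ 2 := by
  rw [EuclideanSpace.real_norm_sq_eq]; rfl

/-- vector-valued functions, seen as valued in euclidean space. -/
def toE {n : ℕ} (G : Vec n → Vec n) : Vec n → EuclideanSpace ℝ (Fin n) :=
  fun x => WithLp.toLp 2 (G x)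

variable {n : ℕ} (Ω : Set (Vec n)) (Bm : Vec n → Matrix (Fin n) (Fin n) ℝ)

lemma lint_u (u : Vec n → ℝ) :
    (∫⁻ x in Ω, ENNReal.ofReal ((u x) ^ 2)) = eLpNorm u 2 (volume.restrict Ω) ^ 2 := by
  rw [← sq_lint]; simp

lemma lint_G (G : Vec n → Vec n) :
    (∫⁻ x in Ω, ENNReal.ofReal (sqNorm (G x))) = eLpNorm (toE G) 2 (volume.restrict Ω) ^ 2 := by
  rw [← sq_lint]; simp [sqNorm_eq, toE]

lemma l2dist_eq (f g : Vec n → ℝ) :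
    l2dist Ω f g = eLpNorm (f - g) 2 (volume.restrict Ω) ^ 2 := by
  rw [← lint_u]; rfl

lemma l2distV_eq (F G : Vec n → Vec n) :
    l2distV Ω F G = eLpNorm (toE F - toE G) 2 (volume.restrict Ω) ^ 2 := by
  have : toE F - toE G = toE (F - G) := by
    funext x; rfl
  rw [this, ← lint_G]; rfl

lemma aem_toE {μ : Measure (Vec n)} {G : Vec n → Vec n} (h : AEMeasurable G μ) :
    AEStronglyMeasurable (toE G) μ := by
  have : Measurable (fun v : Vec n => (WithLp.toLp 2 v : EuclideanSpace ℝ (Fin n))) :=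
    (PiLp.continuous_toLp 2 _).measurable
  exact (this.comp_aemeasurable h).aestronglyMeasurable

lemma memLp_u {u : Vec n → ℝ} {G : Vec n → Vec n} (h : MemW12zero Ω Bm u G) :
    MemLp u 2 (volume.restrict Ω) := by
  refine ⟨h.1.aestronglyMeasurable, ?_⟩
  have := h.2.2.1
  rw [lint_u] at this
  simpa using this

lemma memLp_G {u : Vec n → ℝ} {G : Vec n → Vec n} (h : MemW12zero Ω Bm u G) :
    MemLp (toE G) 2 (volume.restrict Ω) := by
  refine ⟨aem_toE h.2.1, ?_⟩
  have := h.2.2.2.1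
  rw [lint_G] at this
  simpa using this

variable {Ω} {Bm}

lemma grad_measurable (w : Vec n → ℝ) : Measurable (grad w) :=
  measurable_pi_lambda _ fun i => measurable_fderiv_apply_const ℝ w _

lemma Agrad_measurable (hBm : BoundedLipMatrix Bm) (w : Vec n → ℝ) :
    Measurable (Agrad Bm w) := by
  obtain ⟨-, L, hL⟩ := hBm
  refine measurable_pi_lambda _ fun i => ?_
  simp only [Agrad, Matrix.mulVec, dotProduct]
  refine Finset.measurable_sum _ fun j _ => ?_
  exact (hL i j).continuous.measurable.mul ((measurable_pi_apply j).comp (grad_measurable w))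

lemma finite_res (hΩb : Bornology.IsBounded Ω) : IsFiniteMeasure (volume.restrict Ω) :=
  ⟨by simpa using hΩb.measure_lt_top⟩

lemma memLp_w (hΩb : Bornology.IsBounded Ω) {w : Vec n → ℝ} (hw : IsLipCpt Ω w) :
    MemLp w 2 (volume.restrict Ω) := by
  obtain ⟨⟨L, hL⟩, hc, -⟩ := hw
  exact (hL.continuous.memLp_of_hasCompactSupport hc).restrict _

lemma memLp_Agrad (hΩb : Bornology.IsBounded Ω) (hBm : BoundedLipMatrix Bm)
    {w : Vec n → ℝ} (hw : IsLipCpt Ω w) :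
    MemLp (toE (Agrad Bm w)) 2 (volume.restrict Ω) := by
  have := finite_res hΩb
  have hm := Agrad_measurable hBm w
  obtain ⟨⟨L, hL⟩, hc, -⟩ := hw
  obtain ⟨M, hM⟩ := hBm.1
  have hbd : ∀ x i, |Agrad Bm w x i| ≤ ∑ j : Fin n, |M| * L := by
    intro x i
    simp only [Agrad, Matrix.mulVec, dotProduct]
    refine (Finset.abs_sum_le_sum_abs _ _).trans (Finset.sum_le_sum fun j _ => ?_)
    rw [abs_mul]
    refine mul_le_mul ((hM x i j).trans (le_abs_self _)) ?_ (abs_nonneg _) (abs_nonneg _)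
    have h1 := (fderiv ℝ w x).le_opNorm (Pi.single j 1)
    have h2 : ‖(Pi.single j (1:ℝ) : Vec n)‖ ≤ 1 := by
      rw [pi_norm_le_iff_of_nonneg zero_le_one]
      intro k
      by_cases h : k = j
      · subst h; simp
      · simp [h]
    have h3 : ‖fderiv ℝ w x‖ ≤ L := norm_fderiv_le_of_lipschitz ℝ hL
    calc |grad w x j| = ‖fderiv ℝ w x (Pi.single j 1)‖ := rfl
      _ ≤ _ := h1
      _ ≤ L * 1 := by gcongr
      _ = L := mul_one _
  refine MemLp.of_bound (aem_toE hm.aemeasurable)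
    (Real.sqrt (∑ i : Fin n, (∑ j : Fin n, |M| * L) ^ 2)) (ae_of_all _ fun x => ?_)
  rw [EuclideanSpace.norm_eq]
  refine Real.sqrt_le_sqrt (Finset.sum_le_sum fun i _ => ?_)
  exact pow_le_pow_left₀ (norm_nonneg _) (hbd x i) 2

lemma Agrad_add {v w : Vec n → ℝ} (hv : IsLipCpt Ω v) (hw : IsLipCpt Ω w) :
    ∀ᵐ x ∂(volume.restrict Ω), Agrad Bm (v + w) x = Agrad Bm v x + Agrad Bm w x := by
  obtain ⟨⟨L, hL⟩, -⟩ := hv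
  obtain ⟨⟨L', hL'⟩, -⟩ := hw
  refine ae_restrict_of_ae ?_
  filter_upwards [hL.ae_differentiableAt (μ := volume), hL'.ae_differentiableAt (μ := volume)]
    with x h1 h2
  have : grad (v + w) x = grad v x + grad w x := by
    funext i
    simp [grad, fderiv_add h1 h2]
  simp [Agrad, this, Matrix.mulVec_add]

lemma Agrad_smul (c : ℝ) {v : Vec n → ℝ} (hv : IsLipCpt Ω v) :
    ∀ᵐ x ∂(volume.restrict Ω), Agrad Bm (c • v) x = c • Agrad Bm v x := by
  obtain ⟨⟨L, hL⟩, -⟩ := hv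
  refine ae_restrict_of_ae ?_
  filter_upwards [hL.ae_differentiableAt (μ := volume)] with x h1
  have : grad (c • v) x = c • grad v x := by
    funext i
    simp [grad, fderiv_const_smul h1]
  simp [Agrad, this, Matrix.mulVec_smul]

lemma IsLipCpt.add {v w : Vec n → ℝ} (hv : IsLipCpt Ω v) (hw : IsLipCpt Ω w) :
    IsLipCpt Ω (v + w) := by
  obtain ⟨⟨L, hL⟩, h1, h2⟩ := hv
  obtain ⟨⟨L', hL'⟩, h1', h2'⟩ := hw
  exact ⟨⟨_, hL.add hL'⟩, h1.add h1', (tsupport_add v w).trans (union_subset h2 h2')⟩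

lemma IsLipCpt.smul (c : ℝ) {v : Vec n → ℝ} (hv : IsLipCpt Ω v) :
    IsLipCpt Ω (c • v) := by
  obtain ⟨⟨L, hL⟩, h1, h2⟩ := hv
  refine ⟨⟨_, (lipschitzWith_smul c).comp hL⟩, h1.smul_left (f := fun _ => c), ?_⟩
  exact (closure_mono (Function.support_const_smul_subset c v)).trans h2

lemma IsLipCpt.zero : IsLipCpt Ω (0 : Vec n → ℝ) :=
  ⟨⟨0, LipschitzWith.const 0⟩, HasCompactSupport.zero, by simp [tsupport]⟩

variable (Ω Bm)

/-- The ambient Hilbert space. -/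
abbrev HH := WithLp 2 (Lp ℝ 2 (volume.restrict Ω) ×
  Lp (EuclideanSpace ℝ (Fin n)) 2 (volume.restrict Ω))

/-- Pairs coming from compactly supported Lipschitz functions. -/
def SS : Submodule ℝ (HH Ω) where
  carrier := {p | ∃ w, IsLipCpt Ω w ∧ p.fst =ᵐ[volume.restrict Ω] w ∧
    p.snd =ᵐ[volume.restrict Ω] toE (Agrad Bm w)}
  add_mem' := by
    rintro p q ⟨v, hv, h1, h2⟩ ⟨w, hw, h1', h2'⟩
    refine ⟨v + w, hv.add hw, ?_, ?_⟩
    · exact (Lp.coeFn_add p.fst q.fst).trans (h1.add h1')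
    · refine (Lp.coeFn_add p.snd q.snd).trans ((h2.add h2').trans ?_)
      filter_upwards [Agrad_add (Bm := Bm) hv hw] with x hx
      simp [toE, hx]
  zero_mem' := by
    refine ⟨0, IsLipCpt.zero, Lp.coeFn_zero _ _ _, (Lp.coeFn_zero _ _ _).trans ?_⟩
    refine ae_of_all _ fun x => ?_
    have : grad (0 : Vec n → ℝ) x = 0 := by funext i; simp [grad]
    simp [toE, Agrad, this]
  smul_mem' := by
    rintro c p ⟨v, hv, h1, h2⟩
    refine ⟨c • v, hv.smul c, ?_, ?_⟩
    · exact (Lp.coeFn_smul c p.fst).trans (h1.const_smul c)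
    · refine (Lp.coeFn_smul c p.snd).trans ((h2.const_smul c).trans ?_)
      filter_upwards [Agrad_smul (Bm := Bm) c hv] with x hx
      simp [toE, hx]

variable {Ω Bm}

lemma tendsto_HH {p : ℕ → HH Ω} {q : HH Ω} : Tendsto p atTop (𝓝 q) ↔
    Tendsto (fun k => eLpNorm ((p k).fst - q.fst : Vec n → ℝ) 2 (volume.restrict Ω)) atTop (𝓝 0) ∧
    Tendsto (fun k => eLpNorm ((p k).snd - q.snd : Vec n → EuclideanSpace ℝ (Fin n)) 2
      (volume.restrict Ω)) atTop (𝓝 0) := by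
  rw [← Lp.tendsto_Lp_iff_tendsto_eLpNorm', ← Lp.tendsto_Lp_iff_tendsto_eLpNorm']
  rw [(WithLp.homeomorphProd 2 _ _).isInducing.tendsto_nhds_iff, nhds_prod_eq, tendsto_prod_iff']
  rfl

/-- Lp pairs from members of the Sobolev space lie in the closure. -/
lemma mem_closure_of (hΩb : Bornology.IsBounded Ω) (hBm : BoundedLipMatrix Bm)
    {u : Vec n → ℝ} {G : Vec n → Vec n} (h : MemW12zero Ω Bm u G) :
    (WithLp.toLp 2 ((memLp_u Ω Bm h).toLp, (memLp_G Ω Bm h).toLp) : HH Ω)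
      ∈ (SS Ω Bm).topologicalClosure := by
  obtain ⟨w, hw, h1, h2⟩ := h.2.2.2.2
  refine mem_closure_of_tendsto (b := atTop) (f := fun k => (WithLp.toLp 2 ((memLp_w hΩb (hw k)).toLp,
    (memLp_Agrad hΩb hBm (hw k)).toLp) : HH Ω)) ?_ (Eventually.of_forall fun k => ?_)
  · rw [tendsto_HH]
    constructor
    · rw [← tendsto_sq_zero]
      refine h1.congr fun k => ?_
      rw [l2dist_eq]
      congr 1
      exact eLpNorm_congr_ae ((MemLp.coeFn_toLp (memLp_w hΩb (hw k))).sub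
        (MemLp.coeFn_toLp (memLp_u Ω Bm h))).symm
    · rw [← tendsto_sq_zero]
      refine h2.congr fun k => ?_
      rw [l2distV_eq]
      congr 1
      exact eLpNorm_congr_ae ((MemLp.coeFn_toLp (memLp_Agrad hΩb hBm (hw k))).sub
        (MemLp.coeFn_toLp (memLp_G Ω Bm h))).symm
  · exact ⟨w k, hw k, MemLp.coeFn_toLp (memLp_w hΩb (hw k)),
      MemLp.coeFn_toLp (memLp_Agrad hΩb hBm (hw k))⟩

/-- Back to vector-valued functions. -/
def ofE (G : Vec n → EuclideanSpace ℝ (Fin n)) : Vec n → Vec n := fun x => WithLp.ofLp (G x)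

lemma toE_ofE (G : Vec n → EuclideanSpace ℝ (Fin n)) : toE (ofE G) = G := rfl

lemma memW_of_closure {p : HH Ω} (hp : p ∈ (SS Ω Bm).topologicalClosure) :
    MemW12zero Ω Bm p.fst (ofE p.snd) := by
  have m1 := Lp.memLp p.fst
  have m2 := Lp.memLp p.snd
  refine ⟨m1.1.aemeasurable, ?_, ?_, ?_, ?_⟩
  · exact (PiLp.continuous_ofLp 2 (fun _ : Fin n => ℝ)).measurable.comp_aemeasurable
      m2.1.aemeasurable
  · rw [lint_u]; simpa using m1.2
  · rw [lint_G, toE_ofE]; simpa using m2.2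
  · obtain ⟨q, hq, hlim⟩ := mem_closure_iff_seq_limit.1 hp
    choose w hw h1 h2 using hq
    rw [tendsto_HH] at hlim
    refine ⟨w, hw, ?_, ?_⟩
    · refine (tendsto_sq_zero.2 hlim.1).congr fun k => ?_
      rw [l2dist_eq]
      congr 1
      exact eLpNorm_congr_ae ((h1 k).sub (ae_eq_refl _))
    · refine (tendsto_sq_zero.2 hlim.2).congr fun k => ?_
      rw [l2distV_eq, toE_ofE]
      congr 1
      exact eLpNorm_congr_ae ((h2 k).sub (ae_eq_refl _))

/-- The Luxemburg norm dominates the `L²` norm. -/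
lemma lux_ge {α : Type*} [MeasurableSpace α] {φ : ℝ → ℝ≥0∞} (hφ : IsYoung φ)
    (hφ2 : ∀ t : ℝ, 0 ≤ t → ENNReal.ofReal (t ^ 2) ≤ φ t) (μ : Measure α) (f : α → ℝ) :
    (∫⁻ x, ENNReal.ofReal (f x ^ 2) ∂μ) ^ (1/2 : ℝ) ≤ luxNorm φ μ f := by
  refine le_sInf ?_
  rintro _ ⟨k, ⟨hk, hint⟩, rfl⟩
  have hφ' : ∀ t : ℝ, ENNReal.ofReal (t ^ 2) ≤ φ t := by
    intro t
    rcases le_total 0 t with h | h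
    · exact hφ2 t h
    · rw [← hφ.even]; simpa using hφ2 (-t) (by linarith)
  have h1 : ∫⁻ x, ENNReal.ofReal (f x ^ 2) ∂μ ≤ ENNReal.ofReal k ^ 2 := by
    calc ∫⁻ x, ENNReal.ofReal (f x ^ 2) ∂μ
        = ∫⁻ x, ENNReal.ofReal (k ^ 2) * ENNReal.ofReal ((f x / k) ^ 2) ∂μ := by
          refine lintegral_congr fun x => ?_
          rw [← ENNReal.ofReal_mul (by positivity)]
          congr 1
          field_simp
      _ = ENNReal.ofReal (k ^ 2) * ∫⁻ x, ENNReal.ofReal ((f x / k) ^ 2) ∂μ :=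
          lintegral_const_mul' _ _ ENNReal.ofReal_ne_top
      _ ≤ ENNReal.ofReal (k ^ 2) * 1 := by
          gcongr
          exact (lintegral_mono fun x => hφ' _).trans hint
      _ = _ := by rw [mul_one, ENNReal.ofReal_pow hk.le]
  calc _ ≤ (ENNReal.ofReal k ^ 2) ^ (1/2 : ℝ) := ENNReal.rpow_le_rpow h1 (by norm_num)
    _ = _ := by
      rw [← ENNReal.rpow_natCast, ← ENNReal.rpow_mul]
      norm_num

lemma poincare (hΩb : Bornology.IsBounded Ω)
    {φ : ℝ → ℝ≥0∞} (hφ : IsYoung φ)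
    (hφ2 : ∀ t : ℝ, 0 ≤ t → ENNReal.ofReal (t ^ 2) ≤ φ t)
    {C : ℝ}
    (hOS : ∀ w G, MemW12zero Ω Bm w G →
      luxNorm φ (normMeasure Ω) w ≤ ENNReal.ofReal C *
        (∫⁻ x, ENNReal.ofReal (sqNorm (G x)) ∂(normMeasure Ω)) ^ (1/2 : ℝ))
    {u : Vec n → ℝ} {G : Vec n → Vec n} (h : MemW12zero Ω Bm u G) :
    eLpNorm u 2 (volume.restrict Ω) ≤
      ENNReal.ofReal C * eLpNorm (toE G) 2 (volume.restrict Ω) := by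
  by_cases h0 : volume Ω = 0
  · rw [Measure.restrict_eq_zero.2 h0]; simp
  have hT : volume Ω ≠ ⊤ := hΩb.measure_lt_top.ne
  have key := (lux_ge hφ hφ2 (normMeasure Ω) u).trans (hOS u G h)
  have hs : ∀ a : ℝ≥0∞, (a ^ 2) ^ (1/2 : ℝ) = a := by
    intro a
    rw [← ENNReal.rpow_natCast, ← ENNReal.rpow_mul]
    norm_num
  simp only [normMeasure, lintegral_smul_measure, smul_eq_mul] at key
  rw [lint_u, lint_G, ENNReal.mul_rpow_of_nonneg _ _ (by norm_num),
    ENNReal.mul_rpow_of_nonneg _ _ (by norm_num), hs, hs, mul_left_comm] at key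
  have hc0 : ((volume Ω)⁻¹) ^ (1/2 : ℝ) ≠ 0 := by
    simp [ENNReal.rpow_eq_zero_iff, hT, h0]
  have hcT : ((volume Ω)⁻¹) ^ (1/2 : ℝ) ≠ ⊤ := by
    simp [ENNReal.rpow_eq_top_iff, hT, h0]
  exact (ENNReal.mul_le_mul_iff_right hc0 hcT).1 key

lemma inner_snd {F G : Vec n → Vec n} {p q : Lp (EuclideanSpace ℝ (Fin n)) 2 (volume.restrict Ω)}
    (hp : p =ᵐ[volume.restrict Ω] toE F) (hq : q =ᵐ[volume.restrict Ω] toE G) :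
    inner ℝ p q = ∫ x in Ω, ∑ i, F x i * G x i := by
  rw [L2.inner_def]
  refine integral_congr_ae ?_
  filter_upwards [hp, hq] with x h1 h2
  rw [h1, h2]
  simp [toE, PiLp.inner_apply, mul_comm]

lemma inner_fst {f g : Vec n → ℝ} {p q : Lp ℝ 2 (volume.restrict Ω)}
    (hp : p =ᵐ[volume.restrict Ω] f) (hq : q =ᵐ[volume.restrict Ω] g) :
    inner ℝ p q = ∫ x in Ω, f x * g x := by
  rw [L2.inner_def]
  refine integral_congr_ae ?_
  filter_upwards [hp, hq] with x h1 h2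
  rw [h1, h2]
  simp [mul_comm]

end Aux

/-- If the Orlicz–Sobolev inequality
`‖w‖_{L^φ(Ω,dμ)} ≤ C (∫_Ω |∇_A w|² dμ)^{1/2}` holds on `(W_A^{1,2})₀(Ω)` for a Young
function `φ` with `φ(t) ≥ t²` for all `t ≥ 0`, then for every `f ∈ L^∞(Ω)` there exists a
pair `(u, ∇_A u) ∈ (W_A^{1,2})₀(Ω)`, unique as a pair, such that `u` is a weak solution of
`∇·A∇u = f` in `Ω`. -/
theorem statement5 {n : ℕ} (Ω : Set (Vec n)) (hΩo : IsOpen Ω) (hΩb : Bornology.IsBounded Ω)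
    (Bm : Vec n → Matrix (Fin n) (Fin n) ℝ) (hBm : BoundedLipMatrix Bm)
    (φ : ℝ → ℝ≥0∞) (hφ : IsYoung φ)
    (hφ2 : ∀ t : ℝ, 0 ≤ t → ENNReal.ofReal (t ^ 2) ≤ φ t)
    (C : ℝ)
    (hOS : ∀ w G, MemW12zero Ω Bm w G →
      luxNorm φ (normMeasure Ω) w ≤ ENNReal.ofReal C *
        (∫⁻ x, ENNReal.ofReal (sqNorm (G x)) ∂(normMeasure Ω)) ^ (1/2 : ℝ)) :
    ∀ f : Vec n → ℝ, AEMeasurable f (volume.restrict Ω) →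
      eLpNorm f ⊤ (volume.restrict Ω) < ⊤ →
      ∃ u G, IsWeakSol Ω Bm f u G ∧
        ∀ u' G', IsWeakSol Ω Bm f u' G' →
          u' =ᵐ[volume.restrict Ω] u ∧ G' =ᵐ[volume.restrict Ω] G := by
  intro f hfm hfb
  have hfin := finite_res hΩb
  have hf2 : MemLp f 2 (volume.restrict Ω) :=
    MemLp.mono_exponent (q := ⊤) ⟨hfm.aestronglyMeasurable, hfb⟩ le_top
  -- Poincare inequality on the closed subspace
  have hP : ∀ p : HH Ω, p ∈ (SS Ω Bm).topologicalClosure → ‖p.fst‖ ≤ max C 0 * ‖p.snd‖ := by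
    intro p hp
    have h := poincare hΩb hφ hφ2 hOS (memW_of_closure hp)
    rw [toE_ofE] at h
    have h' := ENNReal.toReal_mono (ENNReal.mul_ne_top ENNReal.ofReal_ne_top (Lp.memLp p.snd).2.ne) h
    rw [ENNReal.toReal_mul, ENNReal.toReal_ofReal'] at h'
    rw [Lp.norm_def, Lp.norm_def]
    exact h'
  let K := (SS Ω Bm).topologicalClosure
  have hKc : CompleteSpace K := (Submodule.isClosed_topologicalClosure _).completeSpace_coe
  let T : K →L[ℝ] Lp (EuclideanSpace ℝ (Fin n)) 2 (volume.restrict Ω) :=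
    (WithLp.sndL 2 ℝ _ _).comp K.subtypeL
  let U : K →L[ℝ] Lp ℝ 2 (volume.restrict Ω) := (WithLp.fstL 2 ℝ _ _).comp K.subtypeL
  let B : K →L[ℝ] K →L[ℝ] ℝ := (innerSL ℝ).bilinearComp T T
  have hB : ∀ p q : K, B p q = inner ℝ (p : HH Ω).snd (q : HH Ω).snd := fun p q => rfl
  have hco : IsCoercive B := by
    refine ⟨(max C 0 ^ 2 + 1)⁻¹, by positivity, fun p => ?_⟩
    rw [hB, real_inner_self_eq_norm_sq]
    have h1 := hP p p.2
    have h2 : ‖p‖ * ‖p‖ = ‖(p : HH Ω).fst‖ ^ 2 + ‖(p : HH Ω).snd‖ ^ 2 := by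
      rw [← pow_two, ← WithLp.prod_norm_sq_eq_of_L2]; rfl
    have h3 : ‖(p : HH Ω).fst‖ ^ 2 ≤ max C 0 ^ 2 * ‖(p : HH Ω).snd‖ ^ 2 := by
      rw [← mul_pow]
      exact pow_le_pow_left₀ (norm_nonneg _) h1 2
    rw [mul_assoc, h2, inv_mul_le_iff₀ (by positivity)]
    linarith
  let ℓ : K →L[ℝ] ℝ := -((innerSL ℝ hf2.toLp).comp U)
  let v : K := hco.continuousLinearEquivOfBilin.symm ((InnerProductSpace.toDual ℝ K).symm ℓ)
  have hv : ∀ q : K, B v q = ℓ q := by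
    intro q
    rw [← hco.continuousLinearEquivOfBilin_apply]
    simp [v]
  refine ⟨(v : HH Ω).fst, ofE (v : HH Ω).snd, ⟨memW_of_closure v.2, ?_⟩, ?_⟩
  · intro ψ hψ
    let q : HH Ω := WithLp.toLp 2 ((memLp_w hΩb hψ).toLp, (memLp_Agrad hΩb hBm hψ).toLp)
    have hq : q ∈ K := Submodule.le_topologicalClosure _
      ⟨ψ, hψ, MemLp.coeFn_toLp (memLp_w hΩb hψ),
        MemLp.coeFn_toLp (memLp_Agrad hΩb hBm hψ)⟩
    have h1 := hv ⟨q, hq⟩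
    rw [hB] at h1
    rw [← inner_snd (F := ofE (v : HH Ω).snd) (p := (v : HH Ω).snd) (ae_eq_refl _)
      (MemLp.coeFn_toLp (memLp_Agrad hΩb hBm hψ)),
      ← inner_fst (MemLp.coeFn_toLp hf2) (MemLp.coeFn_toLp (memLp_w hΩb hψ))]
    exact h1
  · rintro u' G' ⟨hW, hweak⟩
    let p : HH Ω := WithLp.toLp 2 ((memLp_u Ω Bm hW).toLp, (memLp_G Ω Bm hW).toLp)
    have hp : p ∈ K := mem_closure_of hΩb hBm hW
    have hSS : ∀ q ∈ SS Ω Bm, inner ℝ (p - v).snd q.snd = 0 := by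
      rintro q ⟨ψ, hψ, h1, h2⟩
      have h3 : inner ℝ (v : HH Ω).snd q.snd = -inner ℝ hf2.toLp q.fst :=
        hv ⟨q, Submodule.le_topologicalClosure _ ⟨ψ, hψ, h1, h2⟩⟩
      have h4 : inner ℝ p.snd q.snd = -inner ℝ hf2.toLp q.fst := by
        rw [inner_snd (p := p.snd) (MemLp.coeFn_toLp (memLp_G Ω Bm hW)) h2,
          inner_fst (MemLp.coeFn_toLp hf2) h1]
        exact hweak ψ hψ
      rw [WithLp.sub_snd, inner_sub_left, h3, h4, sub_self]
    have hK : ∀ q ∈ K, inner ℝ (p - v).snd q.snd = 0 := by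
      intro q hq
      have hcl : IsClosed {q : HH Ω | inner ℝ (p - v).snd q.snd = 0} := by
        refine isClosed_eq ?_ continuous_const
        exact continuous_const.inner (WithLp.sndL 2 ℝ _ _).continuous
      exact closure_minimal (fun q hq => hSS q hq) hcl hq
    have hd : p - v ∈ K := K.sub_mem hp v.2
    have h1 : (p - v).snd = 0 := inner_self_eq_zero.1 (hK _ hd)
    have h2 : (p - v).fst = 0 := by
      have := hP _ hd
      rw [h1, norm_zero, mul_zero] at this
      exact norm_le_zero_iff.1 this
    rw [WithLp.sub_snd, sub_eq_zero] at h1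
    rw [WithLp.sub_fst, sub_eq_zero] at h2
    constructor
    · rw [← h2]
      exact (MemLp.coeFn_toLp (memLp_u Ω Bm hW)).symm
    · rw [← h1]
      filter_upwards [MemLp.coeFn_toLp (memLp_G Ω Bm hW)] with x hx
      exact (congrArg WithLp.ofLp hx).symm
end
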